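/- Fix an integer n ≥ 2. There exists a constant c₂ ≥ 1 such that for every s = (s_2,…,s_n) ∈ (R_v ∖ {0})^{n−1}, every k = (k_1,…,k_n) ∈ Δ_s satisfying 2^{ω(s_i)}·q^{k_i − k_1} ≤ |s_i|/max{1, ln(ln|s_i|)} for all i ∈ {2,…,n}, and every integer m ≥ 1, one has Card{ t ∈ Λ_s : there exists λ ∈ R_v^n ∖ {0} with ‖exp(k)·u_t·λ‖ ≤ q^{−m} } ≤ c₂·q^{−mn}·Card Λ_s. -/

import Mathlib

noncomputable section

open Polynomial
open scoped Classical

variable (Fq : Type) [Field Fq] [Fintype Fq]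

/-- `K_v = F_q((Y⁻¹))`, realized as the field of Laurent series over `F_q`
in the uniformizer `π_v = Y⁻¹`. -/
abbrev Kv := LaurentSeries Fq

/-- The uniformizer `π_v = Y⁻¹` of `K_v`. -/
def piv : Kv Fq := HahnSeries.single (1 : ℤ) (1 : Fq)

/-- The element `Y = π_v⁻¹ ∈ K_v`. -/
def Yv : Kv Fq := HahnSeries.single (-1 : ℤ) (1 : Fq)

/-- The embedding `R_v = F_q[Y] → K_v`, `f ↦ f(Y)`. -/
def polyEmb : Polynomial Fq →+* Kv Fq := Polynomial.eval₂RingHom HahnSeries.C (Yv Fq)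

/-- `R_v = F_q[Y]`, as a subring of `K_v`. -/
def Rv : Subring (Kv Fq) := (polyEmb Fq).range

/-- `K = F_q(Y)`, the fraction field of `R_v`, as a subfield of `K_v`. -/
def Ksub : Subfield (Kv Fq) := Subfield.closure (Rv Fq : Set (Kv Fq))

/-- The normalized absolute value `|x| = q^{-v(x)}` on `K_v`, where `q = Card F_q`. -/
def absv (x : Kv Fq) : ℝ := if x = 0 then 0 else (Fintype.card Fq : ℝ) ^ (-x.order)

/-- `x ∈ π_v^ℓ O_v`. -/
def inPiPow (ℓ : ℤ) (x : Kv Fq) : Prop := x = 0 ∨ ℓ ≤ x.order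

variable (n : ℕ)

/-- The sup norm `‖x‖ = max_i |x_i|` on `K_v^n`. -/
def vnorm (x : Fin n → Kv Fq) : ℝ := ⨆ i, absv Fq (x i)

/-- The `R_v`-lattice `g R_v^n` in `K_v^n` associated with a matrix `g`. -/
def latticeSet (g : Matrix (Fin n) (Fin n) (Kv Fq)) : Set (Fin n → Kv Fq) :=
  {x | ∃ p : Fin n → Polynomial Fq, x = g.mulVec fun i => polyEmb Fq (p i)}

/-- `R_v^n` as a subset of `K_v^n`. -/
def RvN : Set (Fin n → Kv Fq) := {x | ∀ i, x i ∈ Rv Fq}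

lemma absv_zero : absv Fq 0 = 0 := if_pos rfl

lemma absv_one : absv Fq 1 = 1 := by
  rw [absv, if_neg one_ne_zero, HahnSeries.order_one]
  simp

lemma absv_mul (x y : Kv Fq) : absv Fq (x * y) = absv Fq x * absv Fq y := by
  rcases eq_or_ne x 0 with rfl | hx
  · simp [absv]
  rcases eq_or_ne y 0 with rfl | hy
  · simp [absv]
  have hxy : x * y ≠ 0 := mul_ne_zero hx hy
  have hq : (0 : ℝ) < (Fintype.card Fq : ℝ) := by
    exact_mod_cast Fintype.card_pos
  rw [absv, absv, absv, if_neg hxy, if_neg hx, if_neg hy,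
    HahnSeries.order_mul hx hy, neg_add, zpow_add₀ (ne_of_gt hq)]

variable [NeZero n]

/-- The unipotent matrix `u_t ∈ SL_n(K_v)` with first column `(1, t_2, …, t_n)` and
`j`-th column `e_j` for `j ≥ 2`. -/
def uMat (t : Fin n → Kv Fq) : Matrix (Fin n) (Fin n) (Kv Fq) :=
  fun i j => if j = 0 then (if i = 0 then 1 else t i) else (if i = j then 1 else 0)

/-- The diagonal matrix `exp(k) = diag(π^{-k_1},…,π^{-k_n})`. -/
def expD (k : Fin n → ℤ) : Matrix (Fin n) (Fin n) (Kv Fq) :=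
  Matrix.diagonal fun i => piv Fq ^ (-(k i))

/-- The point `t = (r_2/s_2, …, r_n/s_n) ∈ K^{n-1} ⊆ K_v^{n-1}`. -/
def tOf (s r : Fin n → Polynomial Fq) : Fin n → Kv Fq :=
  fun i => if i = 0 then 0 else polyEmb Fq (r i) / polyEmb Fq (s i)

/-- The canonical set of representatives of
`Λ_s = {(r_2/s_2,…,r_n/s_n) mod R_v^{n-1} : r_i R_v + s_i R_v = R_v}`: the tuples
`r = (r_2,…,r_n)` with `r_i` coprime to `s_i` and `deg r_i < deg s_i`. -/
def Tset (s : Fin n → Polynomial Fq) : Set (Fin n → Polynomial Fq) :=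
  {r | r 0 = 0 ∧ ∀ i : Fin n, i ≠ 0 →
    IsCoprime (r i) (s i) ∧ (r i).degree < (s i).degree}

/-- `-v(s_*) = max_{2 ≤ i ≤ n} deg s_i`. -/
def degStar (s : Fin n → Polynomial Fq) : ℕ :=
  (Finset.univ.erase (0 : Fin n)).sup fun i => (s i).natDegree

/-- `v(s_*) = min_{2 ≤ i ≤ n} v(s_i)`. -/
def vstar (s : Fin n → Polynomial Fq) : ℤ := -(degStar Fq n s : ℤ)

/-- `Δ_s = {k ∈ ℤ₀^n : k_1 ≥ v(s_*), k_i ≥ 0 for i ≥ 2}`. -/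
def DeltaSet (s : Fin n → Polynomial Fq) : Set (Fin n → ℤ) :=
  {k | (∑ i, k i) = 0 ∧ vstar Fq n s ≤ k 0 ∧ ∀ i, i ≠ 0 → 0 ≤ k i}

/-- `◊_s = {k ∈ ℤ₀^n : 0 ≤ k_i ≤ k_1 - v(s_*) for i ≥ 2}`. -/
def diamondSet (s : Fin n → Polynomial Fq) : Set (Fin n → ℤ) :=
  {k | (∑ i, k i) = 0 ∧ ∀ i, i ≠ 0 → 0 ≤ k i ∧ k i ≤ k 0 - vstar Fq n s}

/-- The divisibility-chain condition: for some permutation `σ` of `{2,…,n}`,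
`s_{σ(2)} ∣ s_{σ(3)} ∣ … ∣ s_{σ(n)}`. -/
def ChainCond (s : Fin n → Polynomial Fq) : Prop :=
  ∃ σ : Equiv.Perm (Fin n), σ 0 = 0 ∧
    ∀ i j : Fin n, i ≠ 0 → j ≠ 0 → i ≤ j → s (σ i) ∣ s (σ j)

/-- `ω(f)`: the number of distinct monic irreducible factors of `f`. -/
def omegaP (f : Polynomial Fq) : ℕ :=
  (UniqueFactorizationMonoid.normalizedFactors f).toFinset.card

section Factorization

variable {K : Type*} [Field K]

lemma isCoprime_of_ne {P Q : K[X]} (hP : Irreducible P ∧ P.Monic)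
    (hQ : Irreducible Q ∧ Q.Monic) (h : P ≠ Q) : IsCoprime P Q :=
  (hP.1.isCoprime_or_dvd Q).resolve_right fun hdvd =>
    h (eq_of_monic_of_associated hP.2 hQ.2 (hP.1.associated_of_dvd hQ.1 hdvd))

lemma prod_dvd_of_irreducible {S : Finset K[X]} {f : K[X]}
    (hS : ∀ P ∈ S, (Irreducible P ∧ P.Monic) ∧ P ∣ f) : ∏ P ∈ S, P ∣ f :=
  Finset.prod_dvd_of_coprime (fun P hP Q hQ h => isCoprime_of_ne (hS P hP).1 (hS Q hQ).1 h)
    fun P hP => (hS P hP).2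

lemma exists_crt {R : Type*} [CommRing R] {M P : R} (h : IsCoprime P M) (b : R) :
    ∃ b', M ∣ b' - b ∧ P ∣ b' := by
  obtain ⟨u, v, huv⟩ := h
  refine ⟨u * P * b, ⟨-v * b, ?_⟩, ⟨u * b, by ring⟩⟩
  linear_combination b * huv

lemma exists_eq_mul_isCoprime (p : K[X]) {s : K[X]} (hs : s ≠ 0) :
    ∃ g s' p' : K[X], s = g * s' ∧ p = g * p' ∧ IsCoprime p' s' := by
  let := EuclideanDomain.gcdMonoid K[X]
  have hg : GCDMonoid.gcd p s ≠ 0 := gcd_ne_zero_of_right hs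
  exact ⟨GCDMonoid.gcd p s, s / GCDMonoid.gcd p s, p / GCDMonoid.gcd p s,
    (EuclideanDomain.mul_div_cancel' hg (gcd_dvd_right _ _)).symm,
    (EuclideanDomain.mul_div_cancel' hg (gcd_dvd_left _ _)).symm, isCoprime_div_gcd_div_gcd hs⟩

/-- The monic irreducible factors of `f`. -/
def primesOf (f : K[X]) : Finset K[X] :=
  (UniqueFactorizationMonoid.normalizedFactors f).toFinset

lemma mem_primesOf {f P : K[X]} (hf : f ≠ 0) :
    P ∈ primesOf f ↔ (Irreducible P ∧ P.Monic) ∧ P ∣ f := by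
  rw [primesOf, Multiset.mem_toFinset, Polynomial.mem_normalizedFactors_iff hf, and_assoc]

lemma isCoprime_iff_primesOf {r s : K[X]} (hs : s ≠ 0) :
    IsCoprime r s ↔ ∀ P ∈ primesOf s, ¬ P ∣ r := by
  constructor
  · intro h P hP hPr
    rw [mem_primesOf hs] at hP
    exact hP.1.1.not_isUnit (h.isUnit_of_dvd' hPr hP.2)
  · intro h
    refine isCoprime_of_irreducible_dvd (fun h0 => hs h0.2) fun z hz hzr hzs => ?_
    obtain ⟨P, hP, hzP⟩ :=
      UniqueFactorizationMonoid.exists_mem_normalizedFactors_of_dvd hs hz hzs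
    exact h P (Multiset.mem_toFinset.2 hP) (hzP.dvd_iff_dvd_left.1 hzr)

lemma sum_natDegree_le {S : Finset K[X]} {f : K[X]} (hf : f ≠ 0)
    (hS : ∀ P ∈ S, (Irreducible P ∧ P.Monic) ∧ P ∣ f) :
    ∑ P ∈ S, P.natDegree ≤ f.natDegree := by
  rw [← natDegree_prod_of_monic _ _ fun P hP => (hS P hP).1.2]
  exact natDegree_le_of_dvd (prod_dvd_of_irreducible hS) hf

lemma card_primesOf_le {f : K[X]} (hf : f ≠ 0) : (primesOf f).card ≤ f.natDegree := by
  refine le_trans ?_ (sum_natDegree_le hf fun P hP => (mem_primesOf hf).1 hP)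
  rw [Finset.card_eq_sum_ones]
  exact Finset.sum_le_sum fun P hP => ((mem_primesOf hf).1 hP).1.1.natDegree_pos

end Factorization

section Sieve

variable {Fq}

/-- The finite set of polynomials of degree `< N`. -/
def lowDeg (N : ℕ) : Finset Fq[X] :=
  (Finset.univ : Finset (Fin N → Fq)).map
    ((degreeLTEquiv Fq N).symm.toEquiv.toEmbedding.trans (Function.Embedding.subtype _))

lemma mem_lowDeg {N : ℕ} {c : Fq[X]} : c ∈ lowDeg N ↔ c.degree < N := by
  rw [← mem_degreeLT]
  constructor
  · intro h
    obtain ⟨a, -, rfl⟩ := Finset.mem_map.1 h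
    exact ((degreeLTEquiv Fq N).symm a).2
  · intro h
    exact Finset.mem_map.2 ⟨degreeLTEquiv Fq N ⟨c, h⟩, Finset.mem_univ _, by simp⟩

lemma card_lowDeg (N : ℕ) : (lowDeg (Fq := Fq) N).card = Fintype.card Fq ^ N := by
  simp [lowDeg]

lemma one_lt_card_real : (1 : ℝ) < Fintype.card Fq := by
  exact_mod_cast Fintype.one_lt_card

lemma two_le_card_real : (2 : ℝ) ≤ Fintype.card Fq := by
  exact_mod_cast Fintype.one_lt_card (α := Fq)

/-- The polynomials of degree `< N` congruent to `b` modulo `M` and divisible by no element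
of `S`. -/
def sieved (N : ℕ) (M b : Fq[X]) (S : Finset Fq[X]) : Finset Fq[X] :=
  (lowDeg N).filter fun c => M ∣ c - b ∧ ∀ P ∈ S, ¬ P ∣ c

/-- The Euler product `∏_{P ∈ S} (1 - |P|⁻¹)`. -/
def eulerProd (S : Finset Fq[X]) : ℝ :=
  ∏ P ∈ S, (1 - ((Fintype.card Fq : ℝ) ^ P.natDegree)⁻¹)

lemma card_sieved_empty_of_le {N : ℕ} {M : Fq[X]} (b : Fq[X]) (hM : M ≠ 0)
    (h : M.natDegree ≤ N) :
    (sieved N M b ∅).card = Fintype.card Fq ^ (N - M.natDegree) := by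
  have key : ∀ f : Fq[X], (M * f + b % M).degree < N ↔ f.degree < (N - M.natDegree : ℕ) := by
    intro f
    have hb : (b % M).degree < N :=
      (degree_mod_lt b hM).trans_le (degree_le_natDegree.trans (by exact_mod_cast h))
    have hMN : (M * f + b % M).degree < N ↔ (M * f).degree < N := by
      constructor
      · intro hh
        have := (degree_sub_le (M * f + b % M) (b % M)).trans_lt (max_lt hh hb)
        simpa using this
      · intro hh
        exact (degree_add_le _ _).trans_lt (max_lt hh hb)
    rw [hMN]
    rcases eq_or_ne f 0 with rfl | hf
    · simp
    · rw [← natDegree_lt_iff_degree_lt (mul_ne_zero hM hf), ← natDegree_lt_iff_degree_lt hf,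
        natDegree_mul hM hf]
      omega
  rw [← card_lowDeg]
  symm
  refine Finset.card_bij (fun f _ => M * f + b % M) ?_ ?_ ?_
  · intro f hf
    rw [mem_lowDeg] at hf
    simp only [sieved, Finset.mem_filter, mem_lowDeg, key]
    refine ⟨hf, ?_, by simp⟩
    have : M * f + b % M - b = M * (f - b / M) := by
      linear_combination EuclideanDomain.div_add_mod b M
    rw [this]
    exact dvd_mul_right _ _
  · intro f _ g _ hfg
    exact mul_left_cancel₀ hM (add_right_cancel hfg)
  · intro c hc
    simp only [sieved, Finset.mem_filter, mem_lowDeg] at hc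
    obtain ⟨hc, ⟨e, he⟩, -⟩ := hc
    have hce : M * (e + b / M) + b % M = c := by
      linear_combination EuclideanDomain.div_add_mod b M - he
    refine ⟨e + b / M, ?_, hce⟩
    rw [mem_lowDeg, ← key, hce]
    exact hc

lemma card_sieved_empty_of_lt {N : ℕ} {M : Fq[X]} (b : Fq[X]) (h : N < M.natDegree) :
    (sieved N M b ∅).card ≤ 1 := by
  rw [Finset.card_le_one]
  intro c hc d hd
  simp only [sieved, Finset.mem_filter, mem_lowDeg] at hc hd
  have hdvd : M ∣ c - d := by
    have := dvd_sub hc.2.1 hd.2.1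
    simpa using this
  refine sub_eq_zero.1 (eq_zero_of_dvd_of_degree_lt hdvd ?_)
  refine (degree_sub_le c d).trans_lt (max_lt hc.1 hd.1) |>.trans ?_
  rw [degree_eq_natDegree (ne_zero_of_natDegree_gt h)]
  exact_mod_cast h

lemma card_sieved_insert {N : ℕ} {M b b' P : Fq[X]} {S : Finset Fq[X]}
    (hPM : IsCoprime P M) (hb : M ∣ b' - b) (hb' : P ∣ b') :
    ((sieved N M b (insert P S)).card : ℝ)
      = (sieved N M b S).card - (sieved N (M * P) b' S).card := by
  have hunion : sieved N M b S = sieved N M b (insert P S) ∪ sieved N (M * P) b' S := by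
    ext c
    have h1 : M ∣ c - b' ↔ M ∣ c - b := by
      rw [← dvd_add_left hb]; simp
    have h2 : P ∣ c - b' ↔ P ∣ c := dvd_sub_left hb'
    have h3 : M * P ∣ c - b' ↔ M ∣ c - b ∧ P ∣ c := by
      rw [← h1, ← h2]
      exact ⟨fun h => ⟨(dvd_mul_right _ _).trans h, (dvd_mul_left _ _).trans h⟩,
        fun h => hPM.symm.mul_dvd h.1 h.2⟩
    simp only [sieved, Finset.mem_union, Finset.mem_filter, Finset.forall_mem_insert, h3]
    tauto
  have hdisj : Disjoint (sieved N M b (insert P S)) (sieved N (M * P) b' S) := by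
    rw [Finset.disjoint_left]
    intro c hc hc'
    simp only [sieved, Finset.mem_filter, Finset.forall_mem_insert] at hc hc'
    refine hc.2.2.1 ?_
    have : P ∣ c - b' := (dvd_mul_left _ _).trans hc'.2.1
    simpa using dvd_add this hb'
  rw [hunion, Finset.card_union_of_disjoint hdisj]
  push_cast
  ring

/-- Legendre's sieve: the error is at most `2 ^ |S|`, and there is none when all the moduli
that occur have degree at most `N`. -/
lemma card_sieved {N : ℕ} (S : Finset Fq[X]) :
    (∀ P ∈ S, Irreducible P ∧ P.Monic) → ∀ M b : Fq[X], M ≠ 0 → (∀ P ∈ S, IsCoprime P M) →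
    |((sieved N M b S).card : ℝ)
      - (Fintype.card Fq : ℝ) ^ N / (Fintype.card Fq : ℝ) ^ M.natDegree * eulerProd S|
        ≤ 2 ^ S.card ∧
    (M.natDegree + ∑ P ∈ S, P.natDegree ≤ N →
      ((sieved N M b S).card : ℝ)
        = (Fintype.card Fq : ℝ) ^ N / (Fintype.card Fq : ℝ) ^ M.natDegree * eulerProd S) := by
  have hq := one_lt_card_real (Fq := Fq)
  have hq0 : (0 : ℝ) < Fintype.card Fq := by linarith
  induction S using Finset.induction_on with
  | empty =>
    intro _ M b hM _
    have hle : M.natDegree ≤ N → ((sieved N M b ∅).card : ℝ)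
        = (Fintype.card Fq : ℝ) ^ N / (Fintype.card Fq : ℝ) ^ M.natDegree := by
      intro h
      rw [card_sieved_empty_of_le b hM h, Nat.cast_pow, pow_sub₀ _ hq0.ne' h, div_eq_mul_inv]
    simp only [eulerProd, Finset.prod_empty, mul_one, Finset.card_empty, pow_zero,
      Finset.sum_empty, add_zero]
    refine ⟨?_, hle⟩
    rcases le_or_gt M.natDegree N with h | h
    · rw [hle h]; simp
    · have h1 : ((sieved N M b ∅).card : ℝ) ≤ 1 := by
        exact_mod_cast card_sieved_empty_of_lt b h
      have h0 : (0 : ℝ) ≤ (sieved N M b ∅).card := by positivity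
      have h2 : (Fintype.card Fq : ℝ) ^ N / (Fintype.card Fq : ℝ) ^ M.natDegree ≤ 1 :=
        div_le_one_of_le₀ (pow_le_pow_right₀ hq.le h.le) (by positivity)
      have h3 : 0 ≤ (Fintype.card Fq : ℝ) ^ N / (Fintype.card Fq : ℝ) ^ M.natDegree := by
        positivity
      rw [abs_le]
      constructor <;> linarith
  | insert P S hPS ih =>
    intro hirr M b hM hcop
    have hP := hirr P (Finset.mem_insert_self _ _)
    have hPM := hcop P (Finset.mem_insert_self _ _)
    have ih := ih fun Q hQ => hirr Q (Finset.mem_insert_of_mem hQ)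
    obtain ⟨b', hb, hb'⟩ := exists_crt hPM b
    have hcopS : ∀ Q ∈ S, IsCoprime Q M := fun Q hQ => hcop Q (Finset.mem_insert_of_mem hQ)
    have hcopS' : ∀ Q ∈ S, IsCoprime Q (M * P) := by
      intro Q hQ
      exact (hcopS Q hQ).mul_right (isCoprime_of_ne (hirr Q (Finset.mem_insert_of_mem hQ)) hP
        (ne_of_mem_of_not_mem hQ hPS))
    obtain ⟨e1, x1⟩ := ih M b hM hcopS
    obtain ⟨e2, x2⟩ := ih (M * P) b' (mul_ne_zero hM hP.1.ne_zero) hcopS'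
    rw [card_sieved_insert hPM hb hb', eulerProd, Finset.prod_insert hPS,
      Finset.card_insert_of_notMem hPS, Finset.sum_insert hPS, pow_succ]
    rw [natDegree_mul hM hP.1.ne_zero] at e2 x2
    have hmain : (Fintype.card Fq : ℝ) ^ N / (Fintype.card Fq : ℝ) ^ M.natDegree *
        ((1 - ((Fintype.card Fq : ℝ) ^ P.natDegree)⁻¹) * eulerProd S) =
        (Fintype.card Fq : ℝ) ^ N / (Fintype.card Fq : ℝ) ^ M.natDegree * eulerProd S -
        (Fintype.card Fq : ℝ) ^ N / (Fintype.card Fq : ℝ) ^ (M.natDegree + P.natDegree)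
          * eulerProd S := by
      rw [pow_add]
      field_simp
    rw [← eulerProd, hmain]
    constructor
    · rw [abs_le] at *
      constructor <;> linarith
    · intro h
      rw [x1 (by omega), x2 (by omega)]

/-- There are at most `q ^ j / j` monic irreducible polynomials of degree `j`. -/
lemma card_irreducible_le {S : Finset Fq[X]} {j : ℕ} (hj : j ≠ 0)
    (hS : ∀ P ∈ S, Irreducible P ∧ P.Monic ∧ P.natDegree = j) :
    S.card * j ≤ Fintype.card Fq ^ j := by
  have hdvd : ∏ P ∈ S, P ∣ (X ^ (Nat.card Fq) ^ j - X : Fq[X]) :=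
    prod_dvd_of_irreducible fun P hP =>
      ⟨⟨(hS P hP).1, (hS P hP).2.1⟩, (hS P hP).1.natDegree_dvd_iff_dvd_X_pow_card_pow_sub_X.1
        (hS P hP).2.2.dvd⟩
  have hq : 1 < Nat.card Fq := Finite.one_lt_card
  have hle := natDegree_le_of_dvd hdvd (FiniteField.X_pow_card_pow_sub_X_ne_zero _ hj hq)
  rw [FiniteField.X_pow_card_pow_sub_X_natDegree_eq _ hj hq,
    natDegree_prod_of_monic _ _ fun P hP => (hS P hP).2.1,
    Finset.sum_congr rfl fun P hP => (hS P hP).2.2, Finset.sum_const, smul_eq_mul] at hle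
  simpa using hle

lemma sum_inv_irreducible_le {S : Finset Fq[X]} {j : ℕ} (hj : j ≠ 0)
    (hS : ∀ P ∈ S, Irreducible P ∧ P.Monic ∧ P.natDegree = j) :
    ∑ P ∈ S, ((Fintype.card Fq : ℝ) ^ P.natDegree - 1)⁻¹ ≤ (j : ℝ)⁻¹ + 2 * (1 / 2) ^ j := by
  have hj1 : (1 : ℝ) ≤ j := by exact_mod_cast Nat.one_le_iff_ne_zero.2 hj
  have h2 : (2 : ℝ) ^ j ≤ (Fintype.card Fq : ℝ) ^ j :=
    pow_le_pow_left₀ (by norm_num) two_le_card_real j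
  have h2' : (2 : ℝ) ≤ 2 ^ j := by simpa using pow_le_pow_right₀ one_le_two (Nat.pos_of_ne_zero hj)
  have hcard : (S.card : ℝ) * j ≤ (Fintype.card Fq : ℝ) ^ j := by
    exact_mod_cast card_irreducible_le hj hS
  rw [Finset.sum_congr rfl fun P hP => by rw [(hS P hP).2.2], Finset.sum_const, nsmul_eq_mul]
  set x := (Fintype.card Fq : ℝ) ^ j
  have hx : 0 < x - 1 := by linarith
  calc (S.card : ℝ) * (x - 1)⁻¹ ≤ (x / j) * (x - 1)⁻¹ := by
        gcongr
        rwa [le_div_iff₀ (by linarith)]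
    _ = (j : ℝ)⁻¹ + (j : ℝ)⁻¹ * (x - 1)⁻¹ := by field_simp; ring
    _ ≤ (j : ℝ)⁻¹ + 1 * (x - 1)⁻¹ := by
        gcongr
        exact inv_le_one_of_one_le₀ hj1
    _ ≤ (j : ℝ)⁻¹ + 2 * (1 / 2) ^ j := by
        rw [one_mul, one_div, inv_pow]
        gcongr
        rw [← div_eq_mul_inv, ← one_div, div_le_div_iff₀ hx (by positivity)]
        linarith

lemma sum_inv_le {S : Finset Fq[X]} {d : ℕ} (hS : ∀ P ∈ S, Irreducible P ∧ P.Monic)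
    (hd : S.card ≤ d) :
    ∑ P ∈ S, ((Fintype.card Fq : ℝ) ^ P.natDegree - 1)⁻¹
      ≤ 4 + Real.log ((Nat.log 2 d + 1 : ℕ) : ℝ) := by
  set M := Nat.log 2 d + 1 with hM
  have hsmall : ∑ P ∈ S.filter (fun P => P.natDegree ≤ M),
      ((Fintype.card Fq : ℝ) ^ P.natDegree - 1)⁻¹ ≤ 3 + Real.log M := by
    have hmaps : ∀ P ∈ S.filter (fun P => P.natDegree ≤ M), P.natDegree ∈ Finset.Icc 1 M := by
      intro P hP
      rw [Finset.mem_filter] at hP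
      exact Finset.mem_Icc.2 ⟨(hS P hP.1).1.natDegree_pos, hP.2⟩
    rw [← Finset.sum_fiberwise_of_maps_to hmaps]
    calc _ ≤ ∑ j ∈ Finset.Icc 1 M, ((j : ℝ)⁻¹ + 2 * (1 / 2) ^ j) := by
          refine Finset.sum_le_sum fun j hj => sum_inv_irreducible_le ?_ ?_
          · have := (Finset.mem_Icc.1 hj).1; omega
          · intro P hP
            simp only [Finset.mem_filter] at hP
            exact ⟨(hS P hP.1.1).1, (hS P hP.1.1).2, hP.2⟩
      _ ≤ 3 + Real.log M := by
          rw [Finset.sum_add_distrib, ← Finset.mul_sum]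
          have h1 := harmonic_le_one_add_log M
          rw [harmonic_eq_sum_Icc] at h1
          push_cast at h1
          have h2 : ∑ j ∈ Finset.Icc 1 M, (1 / 2 : ℝ) ^ j ≤ 1 := by
            have h3 : ∑ j ∈ Finset.Icc 1 M, (1 / 2 : ℝ) ^ j = 1 - (1 / 2) ^ M := by
              clear_value M
              clear hM h1 hmaps
              induction M with
              | zero => simp
              | succ k ih =>
                rw [Finset.sum_Icc_succ_top (by omega), ih]
                ring
            rw [h3]
            have : (0 : ℝ) ≤ (1 / 2) ^ M := by positivity
            linarith
          linarith
  have hlarge : ∑ P ∈ S.filter (fun P => ¬ P.natDegree ≤ M),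
      ((Fintype.card Fq : ℝ) ^ P.natDegree - 1)⁻¹ ≤ 1 := by
    have hdM : (d : ℝ) + 1 ≤ 2 ^ M := by
      exact_mod_cast Nat.lt_pow_succ_log_self (b := 2) (by norm_num) d
    have hterm : ∀ P ∈ S.filter (fun P => ¬ P.natDegree ≤ M),
        ((Fintype.card Fq : ℝ) ^ P.natDegree - 1)⁻¹ ≤ (d : ℝ)⁻¹ := by
      intro P hP
      rw [Finset.mem_filter, not_le] at hP
      have hd0 : (0 : ℝ) < d := by
        exact_mod_cast (Finset.card_pos.2 ⟨P, hP.1⟩).trans_le hd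
      refine inv_anti₀ hd0 ?_
      have h1 : (2 : ℝ) ^ M ≤ (Fintype.card Fq : ℝ) ^ M :=
        pow_le_pow_left₀ (by norm_num) two_le_card_real M
      have h2 : (Fintype.card Fq : ℝ) ^ M ≤ (Fintype.card Fq : ℝ) ^ P.natDegree :=
        pow_le_pow_right₀ one_lt_card_real.le hP.2.le
      linarith
    refine (Finset.sum_le_card_nsmul _ _ _ hterm).trans ?_
    rw [nsmul_eq_mul, ← div_eq_mul_inv]
    refine div_le_one_of_le₀ ?_ (by positivity)
    exact_mod_cast (Finset.card_filter_le _ _).trans hd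
  rw [← Finset.sum_filter_add_sum_filter_not S (fun P => P.natDegree ≤ M)]
  linarith

lemma eulerProd_term_pos {P : Fq[X]} (hP : Irreducible P) :
    0 < 1 - ((Fintype.card Fq : ℝ) ^ P.natDegree)⁻¹ := by
  rw [sub_pos]
  exact inv_lt_one_of_one_lt₀ (one_lt_pow₀ one_lt_card_real hP.natDegree_pos.ne')

lemma eulerProd_nonneg {S : Finset Fq[X]} (hS : ∀ P ∈ S, Irreducible P ∧ P.Monic) :
    0 ≤ eulerProd S :=
  Finset.prod_nonneg fun P hP => (eulerProd_term_pos (hS P hP).1).le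

lemma natLog_add_one_le (d : ℕ) :
    ((Nat.log 2 d + 1 : ℕ) : ℝ)
      ≤ 5 * max 1 (Real.log (Real.log ((Fintype.card Fq : ℝ) ^ d))) := by
  have hT1 := le_max_left 1 (Real.log (Real.log ((Fintype.card Fq : ℝ) ^ d)))
  have hT2 := le_max_right 1 (Real.log (Real.log ((Fintype.card Fq : ℝ) ^ d)))
  rcases Nat.eq_zero_or_pos d with rfl | hd
  · simp
  have hd0 : (0 : ℝ) < d := by exact_mod_cast hd
  have hlog2 := Real.log_two_gt_d9
  have hlq : Real.log 2 ≤ Real.log (Fintype.card Fq) :=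
    Real.log_le_log (by norm_num) two_le_card_real
  have hl : -1 ≤ Real.log (Real.log (Fintype.card Fq)) := by
    rw [Real.le_log_iff_exp_le (by linarith), Real.exp_neg]
    have := Real.exp_one_gt_d9
    have h1 : (Real.exp 1)⁻¹ ≤ 2⁻¹ := inv_anti₀ (by norm_num) (by linarith)
    linarith
  have hsplit : Real.log (Real.log ((Fintype.card Fq : ℝ) ^ d))
      = Real.log d + Real.log (Real.log (Fintype.card Fq)) := by
    rw [Real.log_pow, Real.log_mul hd0.ne' (by linarith)]
  have hnat : (Nat.log 2 d : ℝ) * Real.log 2 ≤ Real.log d := by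
    rw [← Real.log_pow]
    refine Real.log_le_log (by positivity) ?_
    exact_mod_cast Nat.pow_log_le_self 2 hd.ne'
  have h0 : (0 : ℝ) ≤ Nat.log 2 d := by positivity
  push_cast
  nlinarith

/-- A Mertens-type lower bound for Euler products over at most `d` primes. -/
lemma one_le_mul_eulerProd {S : Finset Fq[X]} {d : ℕ} (hS : ∀ P ∈ S, Irreducible P ∧ P.Monic)
    (hd : S.card ≤ d) :
    1 ≤ 5 * Real.exp 4 * max 1 (Real.log (Real.log ((Fintype.card Fq : ℝ) ^ d)))
      * eulerProd S := by
  have hprod : Real.exp (-∑ P ∈ S, ((Fintype.card Fq : ℝ) ^ P.natDegree - 1)⁻¹)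
      ≤ eulerProd S := by
    rw [← Finset.sum_neg_distrib, Real.exp_sum]
    refine Finset.prod_le_prod (fun _ _ => (Real.exp_pos _).le) fun P hP => ?_
    have hx : 1 < (Fintype.card Fq : ℝ) ^ P.natDegree :=
      one_lt_pow₀ one_lt_card_real (hS P hP).1.natDegree_pos.ne'
    set x := (Fintype.card Fq : ℝ) ^ P.natDegree
    have hx1 : 0 < x - 1 := by linarith
    have he := Real.add_one_le_exp (x - 1)⁻¹
    have h1 : 1 - x⁻¹ = ((x - 1)⁻¹ + 1)⁻¹ := by
      have : x ≠ 0 := by linarith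
      field_simp
      ring
    rw [Real.exp_neg, h1]
    exact inv_anti₀ (by positivity) he
  have hM := natLog_add_one_le (Fq := Fq) d
  have hM0 : (0 : ℝ) < ((Nat.log 2 d + 1 : ℕ) : ℝ) := by positivity
  have hsum := sum_inv_le hS hd
  have hlow : (Real.exp 4 * ((Nat.log 2 d + 1 : ℕ) : ℝ))⁻¹ ≤ eulerProd S := by
    refine le_trans ?_ hprod
    rw [← Real.exp_log hM0, ← Real.exp_add, ← Real.exp_neg, Real.exp_le_exp]
    linarith
  rw [inv_le_iff_one_le_mul₀ (by positivity)] at hlow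
  refine hlow.trans ?_
  have h0 := eulerProd_nonneg hS
  nlinarith [mul_le_mul_of_nonneg_right hM (mul_nonneg (Real.exp_pos 4).le h0)]

/-- The residues modulo `s` coprime to `s`. -/
def coprimeResidues (s : Fq[X]) : Finset Fq[X] :=
  (lowDeg s.natDegree).filter fun r => IsCoprime r s

lemma card_coprimeResidues {s : Fq[X]} (hs : s ≠ 0) :
    ((coprimeResidues s).card : ℝ)
      = (Fintype.card Fq : ℝ) ^ s.natDegree * eulerProd (primesOf s) := by
  have h : coprimeResidues s = sieved s.natDegree 1 0 (primesOf s) := by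
    simp only [coprimeResidues, sieved, isCoprime_iff_primesOf hs, isUnit_one.dvd, true_and]
  have hP : ∀ P ∈ primesOf s, (Irreducible P ∧ P.Monic) ∧ P ∣ s :=
    fun P hP => (mem_primesOf hs).1 hP
  rw [h, (card_sieved _ (fun P h => (hP P h).1) 1 0 one_ne_zero
    fun _ _ => isCoprime_one_right).2 (by simpa using sum_natDegree_le hs hP)]
  simp

lemma card_sieved_le {s' : Fq[X]} {N d : ℕ} (hs' : s' ≠ 0) (hd : s'.natDegree ≤ d)
    (h : 2 ^ (primesOf s').card * max 1 (Real.log (Real.log ((Fintype.card Fq : ℝ) ^ d)))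
      ≤ (Fintype.card Fq : ℝ) ^ (N - 1)) :
    ((sieved N 1 0 (primesOf s')).card : ℝ)
      ≤ (1 + 5 * Real.exp 4) * (Fintype.card Fq : ℝ) ^ N * eulerProd (primesOf s') := by
  have hP : ∀ P ∈ primesOf s', Irreducible P ∧ P.Monic :=
    fun P hP => ((mem_primesOf hs').1 hP).1
  have h1 := (abs_le.1 (card_sieved (N := N) _ hP 1 0 one_ne_zero
    fun _ _ => isCoprime_one_right).1).2
  simp only [natDegree_one, pow_zero, div_one] at h1
  have hmert := one_le_mul_eulerProd hP ((card_primesOf_le hs').trans hd)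
  have hE := eulerProd_nonneg hP
  have hpow : (Fintype.card Fq : ℝ) ^ (N - 1) ≤ (Fintype.card Fq : ℝ) ^ N :=
    pow_le_pow_right₀ one_lt_card_real.le (Nat.sub_le _ _)
  have h2 : (2 : ℝ) ^ (primesOf s').card
      ≤ 5 * Real.exp 4 * (Fintype.card Fq : ℝ) ^ N * eulerProd (primesOf s') := by
    calc (2 : ℝ) ^ (primesOf s').card ≤ 2 ^ (primesOf s').card *
          (5 * Real.exp 4 * max 1 (Real.log (Real.log ((Fintype.card Fq : ℝ) ^ d)))
            * eulerProd (primesOf s')) := le_mul_of_one_le_right (by positivity) hmert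
      _ = 5 * Real.exp 4 * (2 ^ (primesOf s').card *
          max 1 (Real.log (Real.log ((Fintype.card Fq : ℝ) ^ d)))) *
            eulerProd (primesOf s') := by ring
      _ ≤ _ := by
        gcongr
        exact h.trans hpow
  linarith

/-- For fixed `p₀ ≠ 0`, the number of `r` coprime to `s` for which `p₀ r / s` is at distance
at most `q ^ (-a)` from a polynomial. -/
lemma card_approx_le {s p₀ : Fq[X]} (hs : s ≠ 0) (hp₀ : p₀ ≠ 0) {a : ℕ}
    (ha : a + p₀.natDegree ≤ s.natDegree)
    (h : 2 ^ omegaP Fq s * max 1 (Real.log (Real.log ((Fintype.card Fq : ℝ) ^ s.natDegree)))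
      ≤ (Fintype.card Fq : ℝ) ^ (s.natDegree - a - p₀.natDegree)) :
    (((coprimeResidues s).filter fun r =>
        ∃ p : Fq[X], (p * s + p₀ * r).degree < (s.natDegree - a + 1 : ℕ)).card : ℝ)
      ≤ (1 + 5 * Real.exp 4) * Fintype.card Fq * ((Fintype.card Fq : ℝ) ^ a)⁻¹
        * (coprimeResidues s).card := by
  have hq := one_lt_card_real (Fq := Fq)
  have hq0 : (0 : ℝ) < Fintype.card Fq := by linarith
  obtain ⟨g, s', p', hsg, hpg, u, v, huv⟩ := exists_eq_mul_isCoprime p₀ hs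
  have hcop : IsCoprime p' s' := ⟨u, v, huv⟩
  have hg : g ≠ 0 := by rintro rfl; simp at hsg; exact hs hsg
  have hs' : s' ≠ 0 := by rintro rfl; simp at hsg; exact hs hsg
  have hp' : p' ≠ 0 := by rintro rfl; simp at hpg; exact hp₀ hpg
  have hdegs : s.natDegree = g.natDegree + s'.natDegree := by rw [hsg, natDegree_mul hg hs']
  have hdegp : p₀.natDegree = g.natDegree + p'.natDegree := by rw [hpg, natDegree_mul hg hp']
  have hsub : primesOf s' ⊆ primesOf s := by
    intro P hP
    rw [mem_primesOf hs'] at hP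
    rw [mem_primesOf hs, hsg]
    exact ⟨hP.1, hP.2.mul_left g⟩
  set S := primesOf s \ primesOf s'
  have hSP : ∀ P ∈ S, (Irreducible P ∧ P.Monic) ∧ P ∣ s := fun P hP =>
    (mem_primesOf hs).1 (Finset.mem_sdiff.1 hP).1
  have hScop : ∀ P ∈ S, IsCoprime P s' := fun P hP =>
    ((hSP P hP).1.1.isCoprime_or_dvd s').resolve_right fun hdvd =>
      (Finset.mem_sdiff.1 hP).2 ((mem_primesOf hs').2 ⟨(hSP P hP).1, hdvd⟩)
  have hSdeg : s'.natDegree + ∑ P ∈ S, P.natDegree ≤ s.natDegree := by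
    rw [← natDegree_prod_of_monic _ _ fun P hP => (hSP P hP).1.2,
      ← natDegree_mul hs' (Finset.prod_ne_zero_iff.2 fun P hP => (hSP P hP).1.1.ne_zero)]
    refine natDegree_le_of_dvd (IsCoprime.mul_dvd ?_ ⟨g, by rw [hsg, mul_comm]⟩
      (prod_dvd_of_irreducible hSP)) hs
    exact IsCoprime.prod_right fun P hP => (hScop P hP).symm
  set N := s'.natDegree - a + 1
  have hcover : ((coprimeResidues s).filter fun r =>
        ∃ p : Fq[X], (p * s + p₀ * r).degree < (s.natDegree - a + 1 : ℕ)) ⊆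
      (sieved N 1 0 (primesOf s')).biUnion fun c => sieved s.natDegree s' (u * c) S := by
    intro r hr
    simp only [coprimeResidues, Finset.mem_filter] at hr
    obtain ⟨⟨hrlow, hrs⟩, p, hp⟩ := hr
    have hfac : p * s + p₀ * r = g * (p * s' + p' * r) := by rw [hsg, hpg]; ring
    refine Finset.mem_biUnion.2 ⟨p * s' + p' * r, ?_, ?_⟩
    · simp only [sieved, Finset.mem_filter, isUnit_one.dvd, true_and, mem_lowDeg]
      constructor
      · rcases eq_or_ne (p * s' + p' * r) 0 with h0 | h0
        · rw [h0, degree_zero]; exact WithBot.bot_lt_coe _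
        · rw [hfac, ← natDegree_lt_iff_degree_lt (mul_ne_zero hg h0), natDegree_mul hg h0] at hp
          rw [← natDegree_lt_iff_degree_lt h0]
          omega
      · rw [← isCoprime_iff_primesOf hs', add_comm]
        refine IsCoprime.add_mul_right_left ?_ p
        exact hcop.mul_left (hrs.of_isCoprime_of_dvd_right ⟨g, by rw [hsg, mul_comm]⟩)
    · simp only [sieved, Finset.mem_filter]
      refine ⟨hrlow, ⟨v * r - u * p, ?_⟩, fun P hP => ?_⟩
      · linear_combination (-r) * huv
      · exact (isCoprime_iff_primesOf hs).1 hrs P (Finset.mem_sdiff.1 hP).1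
  have hfib : ∀ c, ((sieved s.natDegree s' (u * c) S).card : ℝ)
      = (Fintype.card Fq : ℝ) ^ s.natDegree / (Fintype.card Fq : ℝ) ^ s'.natDegree
        * eulerProd S := fun c =>
    (card_sieved S (fun P hP => (hSP P hP).1) s' (u * c) hs' hScop).2 hSdeg
  have hC := card_sieved_le (N := N) (d := s.natDegree) hs' (by omega) (by
    refine le_trans ?_ (h.trans (pow_le_pow_right₀ hq.le (by omega)))
    gcongr
    · norm_num
    · exact Finset.card_le_card hsub)
  have hE : eulerProd S * eulerProd (primesOf s') = eulerProd (primesOf s) :=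
    Finset.prod_sdiff hsub
  have hES : 0 ≤ eulerProd S := eulerProd_nonneg fun P hP => (hSP P hP).1
  have hNpow : (Fintype.card Fq : ℝ) ^ N * (Fintype.card Fq : ℝ) ^ a
      = Fintype.card Fq * (Fintype.card Fq : ℝ) ^ s'.natDegree := by
    rw [← pow_add, ← pow_succ']
    congr 1
    omega
  calc _ ≤ (((sieved N 1 0 (primesOf s')).biUnion
          fun c => sieved s.natDegree s' (u * c) S).card : ℝ) := by
        exact_mod_cast Finset.card_le_card hcover
    _ ≤ ∑ c ∈ sieved N 1 0 (primesOf s'), ((sieved s.natDegree s' (u * c) S).card : ℝ) := by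
        exact_mod_cast Finset.card_biUnion_le
    _ = (sieved N 1 0 (primesOf s')).card * ((Fintype.card Fq : ℝ) ^ s.natDegree
          / (Fintype.card Fq : ℝ) ^ s'.natDegree * eulerProd S) := by
        rw [Finset.sum_congr rfl fun c _ => hfib c, Finset.sum_const, nsmul_eq_mul]
    _ ≤ (1 + 5 * Real.exp 4) * (Fintype.card Fq : ℝ) ^ N * eulerProd (primesOf s') *
          ((Fintype.card Fq : ℝ) ^ s.natDegree
          / (Fintype.card Fq : ℝ) ^ s'.natDegree * eulerProd S) := by
        gcongr
    _ = _ := by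
        rw [card_coprimeResidues hs, ← hE]
        have : (Fintype.card Fq : ℝ) ^ N = Fintype.card Fq * (Fintype.card Fq : ℝ) ^ s'.natDegree
            * ((Fintype.card Fq : ℝ) ^ a)⁻¹ := by
          rw [← hNpow, mul_inv_cancel_right₀ (by positivity)]
        rw [this]
        field_simp

end Sieve

section Valuation

lemma coeff_polyEmb {Fq : Type} [Field Fq] (f : Fq[X]) (j : ℕ) :
    (polyEmb Fq f).coeff (-(j : ℤ)) = f.coeff j := by
  induction f using Polynomial.induction_on' with
  | add f g hf hg => simp [hf, hg]
  | monomial k a =>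
    have hY : ∀ k : ℕ, Yv Fq ^ k = HahnSeries.single (-(k : ℤ)) (1 : Fq) := by
      intro k
      rw [Yv, HahnSeries.single_pow]
      simp
    have h : polyEmb Fq (monomial k a) = HahnSeries.single (-(k : ℤ)) a := by
      rw [polyEmb, coe_eval₂RingHom, eval₂_monomial, hY, HahnSeries.C_apply,
        HahnSeries.single_mul_single]
      simp
    rw [h, HahnSeries.coeff_single, coeff_monomial]
    simp [eq_comm]

lemma polyEmb_injective {Fq : Type} [Field Fq] :  Function.Injective (polyEmb Fq) := by
  refine (injective_iff_map_eq_zero _).2 fun f hf => ?_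
  ext j
  rw [← coeff_polyEmb, hf]
  simp

variable {Fq}

/-- The absolute value of `K_v` as a monoid homomorphism. -/
def absvHom : Kv Fq →*₀ ℝ where
  toFun := absv Fq
  map_zero' := absv_zero Fq
  map_one' := absv_one Fq
  map_mul' := absv_mul Fq

lemma absv_polyEmb {f : Fq[X]} (hf : f ≠ 0) :
    absv Fq (polyEmb Fq f) = (Fintype.card Fq : ℝ) ^ (f.natDegree : ℤ) := by
  have h0 : polyEmb Fq f ≠ 0 := (map_ne_zero_iff _ polyEmb_injective).2 hf
  have hle : (polyEmb Fq f).order ≤ -(f.natDegree : ℤ) := by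
    refine HahnSeries.order_le_of_coeff_ne_zero ?_
    rw [coeff_polyEmb]
    exact leadingCoeff_ne_zero.2 hf
  have hge : -(f.natDegree : ℤ) ≤ (polyEmb Fq f).order := by
    have hc : (polyEmb Fq f).coeff (polyEmb Fq f).order ≠ 0 :=
      mt HahnSeries.coeff_order_eq_zero.1 h0
    have hj : (polyEmb Fq f).order = -(((-(polyEmb Fq f).order).toNat : ℕ) : ℤ) := by omega
    rw [hj, coeff_polyEmb] at hc
    have := le_natDegree_of_ne_zero hc
    omega
  rw [absv, if_neg h0, le_antisymm hle hge, neg_neg]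

lemma absv_piv_zpow (z : ℤ) : absv Fq (piv Fq ^ z) = (Fintype.card Fq : ℝ) ^ (-z) := by
  have h1 : absv Fq (piv Fq) = (Fintype.card Fq : ℝ)⁻¹ := by
    rw [absv, piv, if_neg (HahnSeries.single_ne_zero one_ne_zero),
      HahnSeries.order_single one_ne_zero, zpow_neg_one]
  change absvHom (piv Fq ^ z) = _
  rw [map_zpow₀, zpow_neg, ← inv_zpow]
  exact congrArg (· ^ z) h1

lemma natDegree_le_of_absv_le {f s : Fq[X]} (hf : f ≠ 0) (hs : s ≠ 0) {k m : ℤ}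
    (h : absv Fq (piv Fq ^ (-k) * (polyEmb Fq f / polyEmb Fq s))
      ≤ (Fintype.card Fq : ℝ) ^ (-m)) :
    f.natDegree + k + m ≤ s.natDegree := by
  have hq0 : (Fintype.card Fq : ℝ) ≠ 0 := by
    have := one_lt_card_real (Fq := Fq)
    linarith
  have hdiv : absv Fq (polyEmb Fq f / polyEmb Fq s)
      = absv Fq (polyEmb Fq f) / absv Fq (polyEmb Fq s) := map_div₀ absvHom _ _
  rw [absv_mul, hdiv, absv_polyEmb hf, absv_polyEmb hs, absv_piv_zpow, ← zpow_sub₀ hq0,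
    ← zpow_add₀ hq0, zpow_le_zpow_iff_right₀ one_lt_card_real] at h
  omega

lemma absv_le_vnorm {n : ℕ} (x : Fin n → Kv Fq) (i : Fin n) : absv Fq (x i) ≤ vnorm Fq n x :=
  le_ciSup (f := fun i => absv Fq (x i)) (Set.finite_range _).bddAbove i

lemma expD_mul_uMat_mulVec {Fq : Type} [Field Fq] {n : ℕ} [NeZero n] (k : Fin n → ℤ)
    (t x : Fin n → Kv Fq) (i : Fin n) :
    (expD Fq n k * uMat Fq n t).mulVec x i
      = piv Fq ^ (-k i) * (if i = 0 then x 0 else t i * x 0 + x i) := by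
  rw [← Matrix.mulVec_mulVec, expD, Matrix.mulVec_diagonal]
  congr 1
  simp only [uMat, Matrix.mulVec, dotProduct]
  rw [← Finset.add_sum_erase _ _ (Finset.mem_univ 0)]
  have hrest : ∑ j ∈ Finset.univ.erase (0 : Fin n),
      (if j = 0 then (if i = 0 then 1 else t i) else (if i = j then 1 else 0)) * x j
      = if i = 0 then 0 else x i := by
    rw [Finset.sum_congr rfl fun j hj => by rw [if_neg (Finset.ne_of_mem_erase hj)]]
    simp only [ite_mul, one_mul, zero_mul, Finset.sum_ite_eq, Finset.mem_erase,
      Finset.mem_univ, and_true]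
    split_ifs <;> simp_all
  rw [hrest, if_pos rfl]
  split_ifs <;> simp

/-- A short vector of `exp(k) u_t R_v^n` has nonzero first coordinate, and yields simultaneous
approximations. -/
lemma approx_of_vnorm_le {n : ℕ} [NeZero n] {s r p : Fin n → Fq[X]} {k : Fin n → ℤ} {m : ℤ}
    (hm : 1 ≤ m) (hs : ∀ i, i ≠ 0 → s i ≠ 0) (hk : ∀ i, i ≠ 0 → 0 ≤ k i)
    (hp : (fun i => polyEmb Fq (p i)) ≠ (0 : Fin n → Kv Fq))
    (h : vnorm Fq n ((expD Fq n k * uMat Fq n (tOf Fq n s r)).mulVec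
      fun i => polyEmb Fq (p i)) ≤ (Fintype.card Fq : ℝ) ^ (-m)) :
    p 0 ≠ 0 ∧ ((p 0).natDegree : ℤ) ≤ -m - k 0 ∧
    ∀ i, i ≠ 0 → p i * s i + p 0 * r i ≠ 0 →
      ((p i * s i + p 0 * r i).natDegree : ℤ) + k i + m ≤ (s i).natDegree := by
  have hcoord := fun i => (absv_le_vnorm _ i).trans h
  simp only [expD_mul_uMat_mulVec] at hcoord
  have hi : ∀ i, i ≠ 0 → p i * s i + p 0 * r i ≠ 0 →
      ((p i * s i + p 0 * r i).natDegree : ℤ) + k i + m ≤ (s i).natDegree := by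
    intro i hi0 hne
    refine natDegree_le_of_absv_le hne (hs i hi0) ?_
    have hsi : polyEmb Fq (s i) ≠ 0 := (map_ne_zero_iff _ polyEmb_injective).2 (hs i hi0)
    have heq : polyEmb Fq (p i * s i + p 0 * r i) / polyEmb Fq (s i)
        = tOf Fq n s r i * polyEmb Fq (p 0) + polyEmb Fq (p i) := by
      rw [tOf, if_neg hi0, map_add, map_mul, map_mul]
      field_simp
      ring
    have := hcoord i
    rwa [if_neg hi0, ← heq] at this
  have hp0 : p 0 ≠ 0 := by
    intro h0
    refine hp (funext fun i => ?_)
    rcases eq_or_ne i 0 with rfl | hi0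
    · simp [h0]
    · by_contra hne
      have hpi : p i ≠ 0 := by
        intro h1
        simp [h1] at hne
      have h2 := hi i hi0 (by simpa [h0] using ⟨hpi, hs i hi0⟩)
      have := hk i hi0
      rw [h0, zero_mul, add_zero, natDegree_mul hpi (hs i hi0)] at h2
      push_cast at h2
      omega
  refine ⟨hp0, ?_, hi⟩
  have h0 := hcoord 0
  rw [if_pos rfl, ← div_one (polyEmb Fq (p 0)), ← map_one (polyEmb Fq)] at h0
  have := natDegree_le_of_absv_le hp0 one_ne_zero h0
  rw [natDegree_one] at this
  omega

end Valuation

section Counting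

variable {Fq} {n : ℕ} [NeZero n]

lemma Tset_eq_piFinset {s : Fin n → Fq[X]} (hs : ∀ i, i ≠ 0 → s i ≠ 0) :
    Tset Fq n s = ↑(Fintype.piFinset fun i => if i = 0 then {0} else coprimeResidues (s i)) := by
  ext r
  simp only [Tset, Set.mem_ofPred_eq, Finset.mem_coe, Fintype.mem_piFinset]
  constructor
  · rintro ⟨h0, h⟩ i
    split_ifs with hi
    · simp [hi, h0]
    · rw [coprimeResidues, Finset.mem_filter, mem_lowDeg, ← degree_eq_natDegree (hs i hi)]
      exact (h i hi).symm
  · intro h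
    refine ⟨by simpa using h 0, fun i hi => ?_⟩
    have := h i
    rw [if_neg hi, coprimeResidues, Finset.mem_filter, mem_lowDeg,
      ← degree_eq_natDegree (hs i hi)] at this
    exact this.symm

lemma card_Tset {s : Fin n → Fq[X]} (hs : ∀ i, i ≠ 0 → s i ≠ 0) :
    (Nat.card (Tset Fq n s) : ℝ)
      = ∏ i, ((if i = 0 then {0} else coprimeResidues (s i) : Finset Fq[X]).card : ℝ) := by
  rw [Tset_eq_piFinset hs, Nat.card_coe_set_eq, Set.ncard_coe_finset, Fintype.card_piFinset,
    Nat.cast_prod]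

/-- The residues `r` coprime to `s` for which `p₀ r / s` is within `q ^ (-a)` of a
polynomial. -/
def approxResidues (s p₀ : Fq[X]) (a : ℕ) : Finset Fq[X] :=
  (coprimeResidues s).filter fun r =>
    ∃ p : Fq[X], (p * s + p₀ * r).degree < (s.natDegree - a + 1 : ℕ)

lemma card_approxResidues_le {s p₀ : Fq[X]} (hs : s ≠ 0) (hp₀ : p₀ ≠ 0) {k k₀ m : ℤ}
    (hk : 0 ≤ k) (hm : 0 ≤ m) (hdeg : (p₀.natDegree : ℤ) ≤ -m - k₀)
    (h : (2 : ℝ) ^ (omegaP Fq s) * (Fintype.card Fq : ℝ) ^ (k - k₀) ≤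
      (Fintype.card Fq : ℝ) ^ s.natDegree /
        max 1 (Real.log (Real.log ((Fintype.card Fq : ℝ) ^ s.natDegree)))) :
    ((approxResidues s p₀ (m + k).toNat).card : ℝ)
      ≤ (1 + 5 * Real.exp 4) * Fintype.card Fq * (Fintype.card Fq : ℝ) ^ (-(m + k))
        * (coprimeResidues s).card := by
  have hq := one_lt_card_real (Fq := Fq)
  have hq0 : (0 : ℝ) < Fintype.card Fq := by linarith
  set T := max 1 (Real.log (Real.log ((Fintype.card Fq : ℝ) ^ s.natDegree))) with hT
  have hT1 : 1 ≤ T := le_max_left _ _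
  have hT0 : 0 < T := by linarith
  have h2 : (1 : ℝ) ≤ 2 ^ omegaP Fq s := one_le_pow₀ (by norm_num)
  have h' : (2 : ℝ) ^ omegaP Fq s * T
      ≤ (Fintype.card Fq : ℝ) ^ ((s.natDegree : ℤ) - (k - k₀)) := by
    rw [le_div_iff₀ hT0] at h
    rw [zpow_sub₀ hq0.ne', le_div_iff₀ (by positivity), zpow_natCast]
    linarith
  have hle : k - k₀ ≤ s.natDegree := by
    have h1 : (Fintype.card Fq : ℝ) ^ (0 : ℤ)
        ≤ (Fintype.card Fq : ℝ) ^ ((s.natDegree : ℤ) - (k - k₀)) := by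
      rw [zpow_zero]
      exact (one_le_mul_of_one_le_of_one_le h2 hT1).trans h'
    rw [zpow_le_zpow_iff_right₀ hq] at h1
    omega
  have hpow : ((Fintype.card Fq : ℝ) ^ (m + k).toNat)⁻¹ = (Fintype.card Fq : ℝ) ^ (-(m + k)) := by
    rw [zpow_neg, ← zpow_natCast, Int.toNat_of_nonneg (by omega)]
  rw [← hpow]
  refine card_approx_le hs hp₀ (by omega) (h'.trans ?_)
  rw [← zpow_natCast, zpow_le_zpow_iff_right₀ hq]
  omega

lemma card_piFinset_approxResidues_le {s : Fin n → Fq[X]} (hs : ∀ i, i ≠ 0 → s i ≠ 0)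
    {k : Fin n → ℤ} (hsum : ∑ i, k i = 0) {m : ℤ} {p₀ : Fq[X]}
    (h : ∀ i, i ≠ 0 → ((approxResidues (s i) p₀ (m + k i).toNat).card : ℝ)
      ≤ (1 + 5 * Real.exp 4) * Fintype.card Fq * (Fintype.card Fq : ℝ) ^ (-(m + k i))
        * (coprimeResidues (s i)).card) :
    ((Fintype.piFinset fun i =>
        if i = 0 then {0} else approxResidues (s i) p₀ (m + k i).toNat).card : ℝ)
      ≤ (Fintype.card Fq : ℝ) ^ (m + k 0) * (((1 + 5 * Real.exp 4) * Fintype.card Fq) ^ n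
        * (Fintype.card Fq : ℝ) ^ (-(m * n)) * Nat.card (Tset Fq n s)) := by
  have hq := one_lt_card_real (Fq := Fq)
  have hq0 : (0 : ℝ) < Fintype.card Fq := by linarith
  set K := (1 + 5 * Real.exp 4) * Fintype.card Fq
  have hK1 : 1 ≤ K := one_le_mul_of_one_le_of_one_le (by linarith [Real.exp_pos 4]) hq.le
  have hprod : ∏ i, (Fintype.card Fq : ℝ) ^ (-(m + k i)) = (Fintype.card Fq : ℝ) ^ (-(m * n)) := by
    have : ∀ t : Finset (Fin n), ∏ i ∈ t, (Fintype.card Fq : ℝ) ^ (-(m + k i))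
        = (Fintype.card Fq : ℝ) ^ (∑ i ∈ t, -(m + k i)) := by
      intro t
      induction t using Finset.induction_on with
      | empty => simp
      | insert i t hi ih => rw [Finset.prod_insert hi, Finset.sum_insert hi, ih, zpow_add₀ hq0.ne']
    rw [this]
    simp [Finset.sum_add_distrib, hsum, mul_comm]
  rw [Fintype.card_piFinset, Nat.cast_prod, card_Tset hs]
  calc _ ≤ ∏ i, (if i = 0 then (Fintype.card Fq : ℝ) ^ (m + k 0) else 1) *
        (K * (Fintype.card Fq : ℝ) ^ (-(m + k i)) *
          ((if i = 0 then {0} else coprimeResidues (s i) : Finset Fq[X]).card : ℝ)) := by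
        refine Finset.prod_le_prod (fun _ _ => by positivity) fun i _ => ?_
        by_cases hi : i = 0
        · subst hi
          simp only [if_true, Finset.card_singleton, Nat.cast_one, mul_one]
          rw [mul_left_comm, ← zpow_add₀ hq0.ne', add_neg_cancel, zpow_zero, mul_one]
          exact hK1
        · simp only [if_neg hi, one_mul]
          exact h i hi
    _ = _ := by
        rw [Finset.prod_mul_distrib, Finset.prod_ite_eq' Finset.univ (0 : Fin n)]
        simp only [Finset.mem_univ, if_true]
        rw [Finset.prod_mul_distrib, Finset.prod_mul_distrib, hprod, Finset.prod_const,
          Finset.card_univ, Fintype.card_fin]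

end Counting

/-- **Lemma 7.2 of the paper** (non-escape of mass, for `R_v = F_q[Y]`, which is principal):
there is `c₂ ≥ 1` such that for every `s`, every `k ∈ Δ_s` satisfying
`2^{ω(s_i)} q^{k_i - k_1} ≤ |s_i|/max{1, ln ln |s_i|}` for all `i ≥ 2`, and every `m ≥ 1`,
the number of `t ∈ Λ_s` such that the lattice `exp(k) u_t R_v^n` has systole `≤ q^{-m}`
is at most `c₂ q^{-mn} Card Λ_s`. -/
theorem no_escape_of_mass_estimate (hn : 2 ≤ n) :
    ∃ c₂ : ℝ, 1 ≤ c₂ ∧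
      ∀ s : Fin n → Polynomial Fq, (∀ i : Fin n, i ≠ 0 → s i ≠ 0) →
      ∀ k : Fin n → ℤ, k ∈ DeltaSet Fq n s →
      (∀ i : Fin n, i ≠ 0 →
        (2 : ℝ) ^ (omegaP Fq (s i)) * (Fintype.card Fq : ℝ) ^ (k i - k 0) ≤
          (Fintype.card Fq : ℝ) ^ (s i).natDegree /
            max 1 (Real.log (Real.log ((Fintype.card Fq : ℝ) ^ (s i).natDegree)))) →
      ∀ m : ℕ, 1 ≤ m →
      (Nat.card {r : Fin n → Polynomial Fq // r ∈ Tset Fq n s ∧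
          ∃ p : Fin n → Polynomial Fq, (fun i => polyEmb Fq (p i)) ≠ (0 : Fin n → Kv Fq) ∧
            vnorm Fq n ((expD Fq n k * uMat Fq n (tOf Fq n s r)).mulVec
              fun i => polyEmb Fq (p i)) ≤ (Fintype.card Fq : ℝ) ^ (-(m : ℤ))} : ℝ) ≤
        c₂ * (Fintype.card Fq : ℝ) ^ (-((m : ℤ) * (n : ℤ))) *
          (Nat.card (Tset Fq n s) : ℝ) := by
  have hq := one_lt_card_real (Fq := Fq)
  have hq0 : (0 : ℝ) < Fintype.card Fq := by linarith
  have hK1 : 1 ≤ (1 + 5 * Real.exp 4) * Fintype.card Fq :=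
    one_le_mul_of_one_le_of_one_le (by linarith [Real.exp_pos 4]) hq.le
  refine ⟨Fintype.card Fq * ((1 + 5 * Real.exp 4) * Fintype.card Fq) ^ n,
    one_le_mul_of_one_le_of_one_le hq.le (one_le_pow₀ hK1), ?_⟩
  rintro s hs k ⟨hsum, -, hk⟩ hbound m hm
  set P := (lowDeg (Fq := Fq) (-m - k 0 + 1).toNat).filter (fun p₀ => p₀ ≠ 0 ∧
    (p₀.natDegree : ℤ) ≤ -m - k 0) with hP
  set W : Fq[X] → Finset (Fin n → Fq[X]) := fun p₀ => Fintype.piFinset fun i =>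
    if i = 0 then {0} else approxResidues (s i) p₀ (m + k i).toNat
  have hcover : {r : Fin n → Polynomial Fq | r ∈ Tset Fq n s ∧
      ∃ p : Fin n → Polynomial Fq, (fun i => polyEmb Fq (p i)) ≠ (0 : Fin n → Kv Fq) ∧
        vnorm Fq n ((expD Fq n k * uMat Fq n (tOf Fq n s r)).mulVec
          fun i => polyEmb Fq (p i)) ≤ (Fintype.card Fq : ℝ) ^ (-(m : ℤ))} ⊆ ↑(P.biUnion W) := by
    rintro r ⟨hr, p, hp, hle⟩
    obtain ⟨hp0, hdeg, happ⟩ := approx_of_vnorm_le (by omega) hs hk hp hle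
    refine Finset.mem_biUnion.2 ⟨p 0, ?_, ?_⟩
    · rw [hP, Finset.mem_filter, mem_lowDeg, ← natDegree_lt_iff_degree_lt hp0]
      exact ⟨by omega, hp0, hdeg⟩
    · rw [Tset_eq_piFinset hs, Finset.mem_coe, Fintype.mem_piFinset] at hr
      refine Fintype.mem_piFinset.2 fun i => ?_
      have hri := hr i
      split_ifs at hri ⊢ with hi
      · exact hri
      · refine Finset.mem_filter.2 ⟨hri, p i, ?_⟩
        rcases eq_or_ne (p i * s i + p 0 * r i) 0 with h0 | h0
        · rw [h0, degree_zero]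
          exact WithBot.bot_lt_coe _
        · have h1 := happ i hi h0
          have h2 := hk i hi
          rw [← natDegree_lt_iff_degree_lt h0]
          omega
  have hcard : (P.card : ℝ) * (Fintype.card Fq : ℝ) ^ ((m : ℤ) + k 0) ≤ Fintype.card Fq := by
    rcases P.eq_empty_or_nonempty with h0 | ⟨p₀, hp₀⟩
    · rw [h0]
      simp
    · have hE : (0 : ℤ) ≤ -m - k 0 := by
        have := (Finset.mem_filter.1 hp₀).2.2
        omega
      have h1 : (P.card : ℝ) ≤ (Fintype.card Fq : ℝ) ^ (-m - k 0 + 1) := by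
        have h2 : P.card ≤ Fintype.card Fq ^ (-m - k 0 + 1).toNat :=
          (Finset.card_filter_le _ _).trans (card_lowDeg _).le
        rw [← Int.toNat_of_nonneg (show 0 ≤ -m - k 0 + 1 by omega), zpow_natCast]
        exact_mod_cast h2
      calc _ ≤ (Fintype.card Fq : ℝ) ^ (-m - k 0 + 1)
              * (Fintype.card Fq : ℝ) ^ ((m : ℤ) + k 0) := by
            gcongr
        _ = Fintype.card Fq := by
            rw [← zpow_add₀ hq0.ne']
            ring_nf
            simp
  have hWcard : ∀ p₀ ∈ P, ((W p₀).card : ℝ) ≤ (Fintype.card Fq : ℝ) ^ ((m : ℤ) + k 0) *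
      (((1 + 5 * Real.exp 4) * Fintype.card Fq) ^ n
        * (Fintype.card Fq : ℝ) ^ (-((m : ℤ) * n)) * Nat.card (Tset Fq n s)) := by
    intro p₀ hp₀
    obtain ⟨-, hne, hdeg⟩ := Finset.mem_filter.1 hp₀
    exact card_piFinset_approxResidues_le hs hsum fun i hi =>
      card_approxResidues_le (hs i hi) hne (hk i hi) (by omega) hdeg (hbound i hi)
  have hfin := Set.ncard_le_ncard hcover (Finset.finite_toSet _)
  rw [Set.ncard_coe_finset] at hfin
  calc _ ≤ ((P.biUnion W).card : ℝ) := by exact_mod_cast hfin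
    _ ≤ ∑ p₀ ∈ P, ((W p₀).card : ℝ) := by exact_mod_cast Finset.card_biUnion_le
    _ ≤ P.card * _ := by
        rw [← nsmul_eq_mul]
        exact Finset.sum_le_card_nsmul _ _ _ hWcard
    _ ≤ Fintype.card Fq * (((1 + 5 * Real.exp 4) * Fintype.card Fq) ^ n
        * (Fintype.card Fq : ℝ) ^ (-((m : ℤ) * n)) * Nat.card (Tset Fq n s)) := by
        rw [← mul_assoc]
        gcongr
    _ = _ := by ring
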